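/- Run IR-PRM⁺ on the simplex Δ(n) with utilities u^(t) and predictions m^(t), and suppose ‖r̃^(1)‖₂ = 1/η for some η > 0. Then the regret satisfies Reg^(T) ≤ 1/η + η Σ_{t=1}^T ‖g^(t)‖₂² − (1/(2nη)) Σ_{t=1}^T ‖x^(t) − x̃^(t)‖₂². -/

import Mathlib

open Matrix

/-- ℓ₂ norm of a vector in ℝ^d. -/
noncomputable def l2 {d : ℕ} (v : Fin d → ℝ) : ℝ := Real.sqrt (∑ i, (v i) ^ 2)

/-- ℓ₁ norm of a vector in ℝ^d. -/
def l1 {d : ℕ} (v : Fin d → ℝ) : ℝ := ∑ i, |v i|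

/-- Standard inner product on ℝ^d. -/
def dotp {d : ℕ} (v w : Fin d → ℝ) : ℝ := ∑ i, v i * w i

/-- Coordinatewise positive part `[v]⁺`. -/
def ppart {d : ℕ} (v : Fin d → ℝ) : Fin d → ℝ := fun i => max (v i) 0

/-- A run of the IR-PRM⁺ algorithm on the simplex `Δ(n)`, with utilities `u`,
predictions `m`, regret vectors `rt` (`r̃`) and `r`, normalization constants
`gam` (`γ`), and strategies `x`, `xt` (`x̃`); `g` is the shifted utility
increment.  All quantities are indexed starting from time `1`. -/
structure IRPRMp (n : ℕ) where
  u : ℕ → Fin n → ℝ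
  m : ℕ → Fin n → ℝ
  rt : ℕ → Fin n → ℝ
  gam : ℕ → ℝ
  r : ℕ → Fin n → ℝ
  x : ℕ → Fin n → ℝ
  xt : ℕ → Fin n → ℝ
  g : ℕ → Fin n → ℝ
  rt1_nonneg : ∀ i, 0 ≤ rt 1 i
  xt1_mem : rt 1 = 0 → xt 1 ∈ stdSimplex ℝ (Fin n)
  xt1_eq : rt 1 ≠ 0 → xt 1 = (l1 (rt 1))⁻¹ • rt 1
  zero_case : ∀ t, 1 ≤ t → rt t = 0 →
      m t = 0 ∧ gam t = 0 ∧ r t = 0 ∧ x t = xt t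
  gam_spec : ∀ t, 1 ≤ t → rt t ≠ 0 →
      l2 (ppart (rt t + m t - gam t • (1 : Fin n → ℝ))) = l2 (rt t)
  r_def : ∀ t, 1 ≤ t → rt t ≠ 0 →
      r t = rt t + m t - gam t • (1 : Fin n → ℝ)
  x_def : ∀ t, 1 ≤ t → rt t ≠ 0 →
      x t = (l1 (ppart (r t)))⁻¹ • ppart (r t)
  g_def : ∀ t, 1 ≤ t →
      g t = u t - m t - (dotp (u t - m t) (x t)) • (1 : Fin n → ℝ)
  rt_succ : ∀ t, 1 ≤ t → rt (t + 1) = ppart (r t + g t)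
  xt_succ_ne : ∀ t, 1 ≤ t → rt (t + 1) ≠ 0 →
      xt (t + 1) = (l1 (rt (t + 1)))⁻¹ • rt (t + 1)
  xt_succ_zero : ∀ t, 1 ≤ t → rt (t + 1) = 0 → xt (t + 1) = x t

theorem l2_sq {d : ℕ} (v : Fin d → ℝ) : l2 v ^ 2 = ∑ i, v i ^ 2 :=
  Real.sq_sqrt (Finset.sum_nonneg fun _ _ => sq_nonneg _)

theorem l1_of_nonneg {d : ℕ} {v : Fin d → ℝ} (hv : ∀ i, 0 ≤ v i) : l1 v = ∑ i, v i :=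
  Finset.sum_congr rfl fun i _ => abs_of_nonneg (hv i)

theorem sum_sq_le_sq_sum_of_nonneg {d : ℕ} {v : Fin d → ℝ} (hv : ∀ i, 0 ≤ v i) :
    ∑ i, v i ^ 2 ≤ (∑ i, v i) ^ 2 := by
  rw [sq (∑ i, v i), Finset.sum_mul]
  refine Finset.sum_le_sum fun i hi => ?_
  rw [sq]
  exact mul_le_mul_of_nonneg_left
    (Finset.single_le_sum (fun j _ => hv j) hi) (hv i)

/-- For nonnegative vectors of equal Euclidean norm, the difference of the coordinate sums
satisfies a Cauchy–Schwarz bound with the improved constant `d - 1`. -/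
theorem sq_sum_sub_sum_le {d : ℕ} {p q : Fin d → ℝ} (hp : ∀ i, 0 ≤ p i) (hq : ∀ i, 0 ≤ q i)
    (hpos : 0 < ∑ i, p i ^ 2) (heq : ∑ i, p i ^ 2 = ∑ i, q i ^ 2) :
    (∑ i, p i - ∑ i, q i) ^ 2 ≤ ((d : ℝ) - 1) * ∑ i, (p i - q i) ^ 2 := by
  set S := ∑ i, (p i + q i) ^ 2 with hS
  set A := ∑ i, (p i + q i) with hA
  have hSpos : 0 < S := hpos.trans_le <| Finset.sum_le_sum fun i _ =>
    pow_le_pow_left₀ (hp i) (by linarith [hq i]) 2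
  have hSA : S ≤ A ^ 2 := sum_sq_le_sq_sum_of_nonneg fun i => add_nonneg (hp i) (hq i)
  have horth : ∑ i, (p i + q i) * (p i - q i) = 0 := by
    have : ∑ i, (p i + q i) * (p i - q i) = ∑ i, p i ^ 2 - ∑ i, q i ^ 2 := by
      rw [← Finset.sum_sub_distrib]
      exact Finset.sum_congr rfl fun i _ => by ring
    rw [this, heq, sub_self]
  have hcs := Finset.sum_mul_sq_le_sq_mul_sq Finset.univ
    (fun i => 1 - A / S * (p i + q i)) (fun i => p i - q i)
  have hleft : ∑ i, (1 - A / S * (p i + q i)) * (p i - q i) = ∑ i, p i - ∑ i, q i := by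
    have : ∀ i, (1 - A / S * (p i + q i)) * (p i - q i)
        = (p i - q i) - A / S * ((p i + q i) * (p i - q i)) := fun i => by ring
    simp only [this]
    rw [Finset.sum_sub_distrib, ← Finset.mul_sum, horth, Finset.sum_sub_distrib]
    ring
  have hright : ∑ i, (1 - A / S * (p i + q i)) ^ 2 = d - A ^ 2 / S := by
    have : ∀ i, (1 - A / S * (p i + q i)) ^ 2
        = 1 - 2 * (A / S) * (p i + q i) + (A / S) ^ 2 * (p i + q i) ^ 2 := fun i => by ring
    simp only [this]
    rw [Finset.sum_add_distrib, Finset.sum_sub_distrib, ← Finset.mul_sum, ← Finset.mul_sum,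
      ← hS, ← hA]
    simp only [Finset.sum_const, Finset.card_univ, Fintype.card_fin, nsmul_eq_mul, mul_one]
    field_simp
    ring
  rw [hleft, hright] at hcs
  refine hcs.trans (mul_le_mul_of_nonneg_right ?_ (Finset.sum_nonneg fun _ _ => sq_nonneg _))
  have : 1 ≤ A ^ 2 / S := (one_le_div hSpos).2 hSA
  linarith

/-- Normalizing nonnegative vectors of equal Euclidean norm onto the simplex. -/
theorem sum_sq_normalize_sub_le {d : ℕ} {p q : Fin d → ℝ} (hp : ∀ i, 0 ≤ p i)
    (hq : ∀ i, 0 ≤ q i) (hpos : 0 < ∑ i, p i ^ 2) (heq : ∑ i, p i ^ 2 = ∑ i, q i ^ 2) :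
    ∑ i, ((∑ j, p j)⁻¹ * p i - (∑ j, q j)⁻¹ * q i) ^ 2
      ≤ d / ((∑ j, p j) * ∑ j, q j) * ∑ i, (p i - q i) ^ 2 := by
  have hab := sq_sum_sub_sum_le hp hq hpos heq
  have haN := sum_sq_le_sq_sum_of_nonneg hp
  have hbN := sum_sq_le_sq_sum_of_nonneg hq
  have ha0 : 0 ≤ ∑ j, p j := Finset.sum_nonneg fun i _ => hp i
  have hb0 : 0 ≤ ∑ j, q j := Finset.sum_nonneg fun i _ => hq i
  set a := ∑ j, p j
  set b := ∑ j, q j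
  have hsplit : ∀ c e : ℝ, ∑ i, (c * p i - e * q i) ^ 2
      = c ^ 2 * ∑ i, p i ^ 2 + e ^ 2 * ∑ i, q i ^ 2 - 2 * (c * e) * ∑ i, p i * q i := by
    intro c e
    rw [Finset.mul_sum, Finset.mul_sum, Finset.mul_sum, ← Finset.sum_add_distrib,
      ← Finset.sum_sub_distrib]
    exact Finset.sum_congr rfl fun i _ => by ring
  have hD := hsplit 1 1
  simp only [one_mul] at hD
  have hX := hsplit a⁻¹ b⁻¹
  rw [← heq] at hD hX hbN
  set N := ∑ i, p i ^ 2
  set D := ∑ i, (p i - q i) ^ 2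
  have ha : 0 < a := lt_of_le_of_ne ha0 fun h => by rw [← h] at haN; linarith
  have hb : 0 < b := lt_of_le_of_ne hb0 fun h => by rw [← h] at hbN; linarith
  have hNab : N ≤ a * b := by
    refine (pow_le_pow_iff_left₀ hpos.le (by positivity) two_ne_zero).1 ?_
    rw [mul_pow, sq N]
    exact mul_le_mul haN hbN hpos.le (sq_nonneg _)
  have hX' : ∑ i, (a⁻¹ * p i - b⁻¹ * q i) ^ 2
      = (N / (a * b) * (a - b) ^ 2 + D) / (a * b) := by
    rw [hX, hD]
    field_simp
    ring
  rw [hX', div_mul_eq_mul_div (d : ℝ)]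
  refine div_le_div_of_nonneg_right ?_ (mul_pos ha hb).le
  have h1 : N / (a * b) * (a - b) ^ 2 ≤ 1 * (a - b) ^ 2 :=
    mul_le_mul_of_nonneg_right ((div_le_one (by positivity)).2 hNab) (sq_nonneg _)
  linarith

theorem ppart_nonneg {d : ℕ} (v : Fin d → ℝ) (i : Fin d) : 0 ≤ ppart v i := le_max_right _ _

namespace IRPRMp

variable {n : ℕ} (alg : IRPRMp n)

theorem rt_nonneg : ∀ t, 1 ≤ t → ∀ i, 0 ≤ alg.rt t i := by
  intro t ht
  induction t, ht using Nat.le_induction with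
  | base => exact alg.rt1_nonneg
  | succ t ht _ =>
    rw [alg.rt_succ t ht]
    exact ppart_nonneg _

theorem xt_eq {t : ℕ} (ht : 1 ≤ t) (h0 : alg.rt t ≠ 0) :
    alg.xt t = (l1 (alg.rt t))⁻¹ • alg.rt t := by
  obtain _ | t := t
  · omega
  obtain rfl | ht' := Nat.eq_zero_or_pos t
  · exact alg.xt1_eq h0
  · exact alg.xt_succ_ne t ht' h0

theorem sum_sq_ppart_r {t : ℕ} (ht : 1 ≤ t) (h0 : alg.rt t ≠ 0) :
    ∑ i, ppart (alg.r t) i ^ 2 = ∑ i, alg.rt t i ^ 2 := by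
  rw [← l2_sq, ← l2_sq, alg.r_def t ht h0, alg.gam_spec t ht h0]

theorem sum_sq_rt_pos {t : ℕ} (h0 : alg.rt t ≠ 0) : 0 < ∑ i, alg.rt t i ^ 2 := by
  obtain ⟨i, hi⟩ := Function.ne_iff.1 h0
  exact Finset.sum_pos' (fun _ _ => sq_nonneg _) ⟨i, Finset.mem_univ _, sq_pos_iff.2 hi⟩

theorem sum_ppart_r_pos {t : ℕ} (ht : 1 ≤ t) (h0 : alg.rt t ≠ 0) :
    0 < ∑ i, ppart (alg.r t) i := by
  have h := sum_sq_le_sq_sum_of_nonneg (ppart_nonneg (alg.r t))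
  rw [alg.sum_sq_ppart_r ht h0] at h
  refine lt_of_le_of_ne (Finset.sum_nonneg fun i _ => ppart_nonneg _ i) fun h' => ?_
  rw [← h'] at h
  linarith [alg.sum_sq_rt_pos h0]

theorem x_apply {t : ℕ} (ht : 1 ≤ t) (h0 : alg.rt t ≠ 0) (i : Fin n) :
    alg.x t i = (∑ j, ppart (alg.r t) j)⁻¹ * ppart (alg.r t) i := by
  rw [alg.x_def t ht h0, l1_of_nonneg (ppart_nonneg _), Pi.smul_apply, smul_eq_mul]

theorem sum_x {t : ℕ} (ht : 1 ≤ t) (h0 : alg.rt t ≠ 0) : ∑ i, alg.x t i = 1 := by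
  simp only [alg.x_apply ht h0]
  rw [← Finset.mul_sum, inv_mul_cancel₀ (alg.sum_ppart_r_pos ht h0).ne']

theorem g_apply {t : ℕ} (ht : 1 ≤ t) (i : Fin n) :
    alg.g t i = alg.u t i - alg.m t i - dotp (alg.u t - alg.m t) (alg.x t) := by
  have h := congrFun (alg.g_def t ht) i
  simpa only [Pi.sub_apply, Pi.smul_apply, Pi.one_apply, smul_eq_mul, mul_one] using h

theorem sum_g_mul_x {t : ℕ} (ht : 1 ≤ t) (h0 : alg.rt t ≠ 0) :
    ∑ i, alg.g t i * alg.x t i = 0 := by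
  simp only [alg.g_apply ht, sub_mul _ (dotp _ _)]
  rw [Finset.sum_sub_distrib, ← Finset.mul_sum, alg.sum_x ht h0, mul_one]
  exact sub_self _

theorem sum_g_mul_ppart_r {t : ℕ} (ht : 1 ≤ t) (h0 : alg.rt t ≠ 0) :
    ∑ i, alg.g t i * ppart (alg.r t) i = 0 := by
  have h := alg.sum_g_mul_x ht h0
  simp only [alg.x_apply ht h0, mul_left_comm _ (∑ j, ppart (alg.r t) j)⁻¹] at h
  rw [← Finset.mul_sum] at h
  exact (mul_eq_zero.1 h).resolve_left (inv_ne_zero (alg.sum_ppart_r_pos ht h0).ne')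

theorem sum_sq_rt_succ_le {t : ℕ} (ht : 1 ≤ t) (h0 : alg.rt t ≠ 0) :
    ∑ i, alg.rt (t + 1) i ^ 2 ≤ ∑ i, alg.rt t i ^ 2 + ∑ i, alg.g t i ^ 2 := by
  have hcoord : ∀ i, alg.rt (t + 1) i ^ 2 ≤ ppart (alg.r t) i ^ 2 + alg.g t i ^ 2
      + 2 * (alg.g t i * ppart (alg.r t) i) := by
    intro i
    rw [alg.rt_succ t ht]
    simp only [ppart, Pi.add_apply]
    have h1 := le_max_left (alg.r t i) 0
    have h2 := le_max_right (alg.r t i) 0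
    rcases max_cases (alg.r t i + alg.g t i) 0 with ⟨h, h'⟩ | ⟨h, h'⟩ <;> rw [h]
    · nlinarith
    · nlinarith [sq_nonneg (max (alg.r t i) 0 + alg.g t i)]
  refine (Finset.sum_le_sum fun i _ => hcoord i).trans_eq ?_
  rw [Finset.sum_add_distrib, Finset.sum_add_distrib, ← Finset.mul_sum,
    alg.sum_g_mul_ppart_r ht h0, alg.sum_sq_ppart_r ht h0]
  ring

theorem sum_sq_rt_le_succ {t : ℕ} (ht : 1 ≤ t) (h0 : alg.rt t ≠ 0) :
    ∑ i, alg.rt t i ^ 2 ≤ ∑ i, alg.rt (t + 1) i ^ 2 := by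
  have hcoord : ∀ i, ppart (alg.r t) i ^ 2 + 2 * (alg.g t i * ppart (alg.r t) i)
      ≤ alg.rt (t + 1) i ^ 2 := by
    intro i
    rw [alg.rt_succ t ht]
    simp only [ppart, Pi.add_apply]
    have h1 := le_max_left (alg.r t i + alg.g t i) 0
    have h2 := le_max_right (alg.r t i + alg.g t i) 0
    rcases max_cases (alg.r t i) 0 with ⟨h, h'⟩ | ⟨h, h'⟩ <;> rw [h]
    · nlinarith [sq_nonneg (max (alg.r t i + alg.g t i) 0 - alg.r t i)]
    · nlinarith
  have h := Finset.sum_le_sum fun i (_ : i ∈ Finset.univ) => hcoord i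
  rwa [Finset.sum_add_distrib, ← Finset.mul_sum, alg.sum_g_mul_ppart_r ht h0,
    alg.sum_sq_ppart_r ht h0, mul_zero, add_zero] at h

theorem rt_ne_zero_of_le {t : ℕ} {c : ℝ} (hc : 0 < c) (h : c ≤ ∑ i, alg.rt t i ^ 2) :
    alg.rt t ≠ 0 := by
  intro h0
  simp only [h0, Pi.zero_apply, ne_eq, OfNat.ofNat_ne_zero, not_false_eq_true, zero_pow,
    Finset.sum_const_zero] at h
  linarith

theorem le_sum_sq_rt {c : ℝ} (hc : 0 < c) (hinit : ∑ i, alg.rt 1 i ^ 2 = c) :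
    ∀ t, 1 ≤ t → c ≤ ∑ i, alg.rt t i ^ 2 := by
  intro t ht
  induction t, ht using Nat.le_induction with
  | base => exact hinit.ge
  | succ t ht ih => exact ih.trans (alg.sum_sq_rt_le_succ ht (alg.rt_ne_zero_of_le hc ih))

theorem sum_sq_rt_le {c : ℝ} (hc : 0 < c) (hinit : ∑ i, alg.rt 1 i ^ 2 = c) (T : ℕ) :
    ∑ i, alg.rt (T + 1) i ^ 2 ≤ c + ∑ t ∈ Finset.Icc 1 T, ∑ i, alg.g t i ^ 2 := by
  induction T with
  | zero => simp [hinit]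
  | succ T ih =>
    rw [Finset.sum_Icc_succ_top (by omega)]
    have := alg.sum_sq_rt_succ_le (t := T + 1) (by omega)
      (alg.rt_ne_zero_of_le hc (alg.le_sum_sq_rt hc hinit _ (by omega)))
    linarith

theorem dotp_sub_x_le {η : ℝ} (hη : 0 < η) {t : ℕ} (ht : 1 ≤ t)
    (hlow : (1 / η) ^ 2 ≤ ∑ i, alg.rt t i ^ 2) {y : Fin n → ℝ}
    (hy : y ∈ stdSimplex ℝ (Fin n)) :
    dotp (y - alg.x t) (alg.u t) ≤ (dotp y (alg.rt (t + 1)) - dotp y (alg.rt t))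
      - 1 / (2 * (n : ℝ) * η) * l2 (alg.x t - alg.xt t) ^ 2 := by
  have h0 : alg.rt t ≠ 0 := alg.rt_ne_zero_of_le (by positivity) hlow
  have hρ := alg.rt_nonneg t ht
  have ha := alg.sum_ppart_r_pos ht h0
  have hn : 0 < (n : ℝ) := by
    obtain ⟨i, -⟩ := Function.ne_iff.1 h0
    exact_mod_cast i.pos
  have hb : 1 / η ≤ ∑ i, alg.rt t i :=
    (pow_le_pow_iff_left₀ (by positivity) (Finset.sum_nonneg fun i _ => hρ i) two_ne_zero).1
      (hlow.trans (sum_sq_le_sq_sum_of_nonneg hρ))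
  have hN := alg.sum_sq_ppart_r ht h0
  have hdist := sum_sq_normalize_sub_le (ppart_nonneg (alg.r t)) hρ
    (hN ▸ alg.sum_sq_rt_pos h0) hN
  have hl2 : l2 (alg.x t - alg.xt t) ^ 2 = ∑ i, ((∑ j, ppart (alg.r t) j)⁻¹ *
      ppart (alg.r t) i - (∑ j, alg.rt t j)⁻¹ * alg.rt t i) ^ 2 := by
    rw [l2_sq]
    refine Finset.sum_congr rfl fun i _ => ?_
    rw [Pi.sub_apply, alg.x_apply ht h0, alg.xt_eq ht h0, l1_of_nonneg hρ, Pi.smul_apply,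
      smul_eq_mul]
  have hu : ∀ i, alg.u t i = alg.g t i + alg.r t i - alg.rt t i
      + (alg.gam t + dotp (alg.u t - alg.m t) (alg.x t)) := by
    intro i
    have hr := congrFun (alg.r_def t ht h0) i
    simp only [Pi.sub_apply, Pi.add_apply, Pi.smul_apply, Pi.one_apply, smul_eq_mul,
      mul_one] at hr
    linarith [alg.g_apply ht i]
  set K := alg.gam t + dotp (alg.u t - alg.m t) (alg.x t)
  have hxr : ∑ i, alg.x t i * (alg.r t i - alg.rt t i)
      = (∑ i, (ppart (alg.r t) i - alg.rt t i) ^ 2) / (2 * ∑ j, ppart (alg.r t) j) := by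
    have hcoord : ∀ i, alg.x t i * (alg.r t i - alg.rt t i)
        = (2 * ∑ j, ppart (alg.r t) j)⁻¹ * ((ppart (alg.r t) i - alg.rt t i) ^ 2
          + (ppart (alg.r t) i ^ 2 - alg.rt t i ^ 2)) := by
      intro i
      have hpr : ppart (alg.r t) i * alg.r t i = ppart (alg.r t) i ^ 2 := by
        simp only [ppart]
        rcases max_cases (alg.r t i) 0 with ⟨h, -⟩ | ⟨h, -⟩ <;> rw [h] <;> ring
      rw [alg.x_apply ht h0, mul_inv]
      linear_combination (∑ j, ppart (alg.r t) j)⁻¹ * hpr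
    simp only [hcoord]
    rw [← Finset.mul_sum, Finset.sum_add_distrib, Finset.sum_sub_distrib, hN, sub_self,
      add_zero, div_eq_inv_mul]
  have hreg : dotp (y - alg.x t) (alg.u t)
      = ∑ i, y i * (alg.r t i + alg.g t i) - dotp y (alg.rt t)
        - ∑ i, alg.x t i * (alg.r t i - alg.rt t i) := by
    have hcoord : ∀ i, (y - alg.x t) i * alg.u t i = y i * (alg.r t i + alg.g t i)
        - y i * alg.rt t i - alg.x t i * (alg.r t i - alg.rt t i) - alg.g t i * alg.x t i
        + K * (y i - alg.x t i) := by
      intro i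
      rw [hu i, Pi.sub_apply]
      ring
    simp only [dotp, hcoord]
    rw [Finset.sum_add_distrib, Finset.sum_sub_distrib, Finset.sum_sub_distrib,
      Finset.sum_sub_distrib, ← Finset.mul_sum, Finset.sum_sub_distrib, hy.2,
      alg.sum_x ht h0, alg.sum_g_mul_x ht h0]
    ring
  have hmono : ∑ i, y i * (alg.r t i + alg.g t i) ≤ dotp y (alg.rt (t + 1)) := by
    refine Finset.sum_le_sum fun i _ => mul_le_mul_of_nonneg_left ?_ (hy.1 i)
    rw [alg.rt_succ t ht]
    exact le_max_left _ _
  have hpen : 1 / (2 * (n : ℝ) * η) * l2 (alg.x t - alg.xt t) ^ 2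
      ≤ ∑ i, alg.x t i * (alg.r t i - alg.rt t i) := by
    rw [hl2, hxr]
    refine (mul_le_mul_of_nonneg_left hdist (by positivity)).trans ?_
    have hD : 0 ≤ ∑ i, (ppart (alg.r t) i - alg.rt t i) ^ 2 :=
      Finset.sum_nonneg fun _ _ => sq_nonneg _
    set D := ∑ i, (ppart (alg.r t) i - alg.rt t i) ^ 2
    set a := ∑ j, ppart (alg.r t) j
    set b := ∑ j, alg.rt t j
    have hbpos : 0 < b := lt_of_lt_of_le (by positivity) hb
    have hηb : 1 ≤ b * η := (div_le_iff₀ hη).1 hb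
    have hrew : 1 / (2 * (n : ℝ) * η) * (n / (a * b) * D) = D / (2 * a) / (b * η) := by
      field_simp
    rw [hrew]
    exact div_le_self (by positivity) hηb
  rw [hreg]
  linarith

end IRPRMp

theorem dotp_le_l2_of_mem_stdSimplex {d : ℕ} {y v : Fin d → ℝ}
    (hy : y ∈ stdSimplex ℝ (Fin d)) : dotp y v ≤ l2 v := by
  have hv : ∀ i, v i ≤ l2 v := fun i => Real.le_sqrt_of_sq_le <|
    Finset.single_le_sum (f := fun i => v i ^ 2) (fun _ _ => sq_nonneg _) (Finset.mem_univ i)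
  calc dotp y v ≤ ∑ i, y i * l2 v :=
        Finset.sum_le_sum fun i _ => mul_le_mul_of_nonneg_left (hv i) (hy.1 i)
    _ = l2 v := by rw [← Finset.sum_mul, hy.2, one_mul]

/-- RVU-type regret bound for IR-PRM⁺ when `‖r̃^(1)‖₂ = 1/η`. -/
theorem stmt12 {n : ℕ} (alg : IRPRMp n) (η : ℝ) (hη : 0 < η)
    (hinit : l2 (alg.rt 1) = 1 / η) (T : ℕ) (hT : 1 ≤ T) :
    sSup ((fun xs : Fin n → ℝ =>
        ∑ t ∈ Finset.Icc 1 T, dotp (xs - alg.x t) (alg.u t)) '' stdSimplex ℝ (Fin n))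
      ≤ 1 / η + η * ∑ t ∈ Finset.Icc 1 T, (l2 (alg.g t)) ^ 2
        - (1 / (2 * (n : ℝ) * η)) *
            ∑ t ∈ Finset.Icc 1 T, (l2 (alg.x t - alg.xt t)) ^ 2 := by
  have hc : 0 < (1 / η) ^ 2 := by positivity
  have hinit' : ∑ i, alg.rt 1 i ^ 2 = (1 / η) ^ 2 := by rw [← l2_sq, hinit]
  have hlow := alg.le_sum_sq_rt hc hinit'
  have hne : (stdSimplex ℝ (Fin n)).Nonempty := by
    obtain ⟨i, -⟩ := Function.ne_iff.1 (alg.rt_ne_zero_of_le hc hinit'.ge)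
    exact ⟨_, single_mem_stdSimplex ℝ i⟩
  refine csSup_le (hne.image _) ?_
  rintro _ ⟨y, hy, rfl⟩
  have hstep : ∑ t ∈ Finset.Icc 1 T, dotp (y - alg.x t) (alg.u t)
      ≤ ∑ t ∈ Finset.Icc 1 T, ((dotp y (alg.rt (t + 1)) - dotp y (alg.rt t))
        - 1 / (2 * (n : ℝ) * η) * l2 (alg.x t - alg.xt t) ^ 2) :=
    Finset.sum_le_sum fun t ht =>
      alg.dotp_sub_x_le hη (Finset.mem_Icc.1 ht).1 (hlow t (Finset.mem_Icc.1 ht).1) hy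
  have htel : ∑ t ∈ Finset.Icc 1 T, (dotp y (alg.rt (t + 1)) - dotp y (alg.rt t))
      = dotp y (alg.rt (T + 1)) - dotp y (alg.rt 1) := by
    rw [← Finset.Ico_add_one_right_eq_Icc]
    exact Finset.sum_Ico_sub (fun t => dotp y (alg.rt t)) (by omega)
  rw [Finset.sum_sub_distrib, ← Finset.mul_sum, htel] at hstep
  have hfirst : 0 ≤ dotp y (alg.rt 1) :=
    Finset.sum_nonneg fun i _ => mul_nonneg (hy.1 i) (alg.rt1_nonneg i)
  have hG : 0 ≤ ∑ t ∈ Finset.Icc 1 T, l2 (alg.g t) ^ 2 :=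
    Finset.sum_nonneg fun _ _ => sq_nonneg _
  have hlast : l2 (alg.rt (T + 1)) ≤ 1 / η + η * ∑ t ∈ Finset.Icc 1 T, l2 (alg.g t) ^ 2 := by
    refine Real.sqrt_le_iff.2 ⟨by positivity, (alg.sum_sq_rt_le hc hinit' T).trans ?_⟩
    simp only [← l2_sq]
    set G := ∑ t ∈ Finset.Icc 1 T, l2 (alg.g t) ^ 2
    have hexp : (1 / η + η * G) ^ 2 = (1 / η) ^ 2 + 2 * G + (η * G) ^ 2 := by
      field_simp
      ring
    rw [hexp]
    nlinarith [sq_nonneg (η * G)]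
  linarith [dotp_le_l2_of_mem_stdSimplex (v := alg.rt (T + 1)) hy]
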